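/- arXiv:1003.3297 — 2 statements merged into one kernel-verified Lean document; each statement's English description precedes it below -/
import Mathlib

section
/- For a positive integer w, y1, y2 ∈ R and n ≥ 0: w · Σ_{k=0}^n C(n,k) · B_{k,q}(w·y1) · B_{n−k,q^w}(y2) · w^{n−k} = Σ_{k+l+m=n} (n choose k,l,m) · B_{k,q^w}(y1) · B_{l,q^w}(y2) · S_{m,q}(w − 1) · w^{k+l}. -/
open Finset

/-- The q-analogue of power sums: `S_{k,q}(m) = Σ_{i=0}^m i^k q^i` (with `0^0 = 1`). -/
def qS {R : Type*} [CommRing R] (q : R) (k m : ℕ) : R :=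
  ∑ i ∈ Finset.range (m + 1), (i : R) ^ k * q ^ i

/-- q-Bernoulli numbers `b_n(q, L)`: `(q-1) b_0 = L` and for `n ≥ 1`,
`(q-1) b_n = [n = 1] - q Σ_{k<n} C(n,k) b_k`. -/
noncomputable def qb {R : Type*} [CommRing R] (q L : R) : ℕ → R
  | 0 => Ring.inverse (q - 1) * L
  | n + 1 =>
      Ring.inverse (q - 1) *
        ((if n + 1 = 1 then (1 : R) else 0) -
          q * ∑ k ∈ (Finset.range (n + 1)).attach,
              ((n + 1).choose k.1 : R) * qb q L k.1)
  termination_by n => n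
  decreasing_by exact Finset.mem_range.mp k.2

/-- q-Bernoulli polynomials `B_{n,q}(x) = Σ_{k=0}^n C(n,k) b_k(q,L) x^{n-k}`. -/
noncomputable def qB {R : Type*} [CommRing R] (q L : R) (n : ℕ) (x : R) : R :=
  ∑ k ∈ Finset.range (n + 1), (n.choose k : R) * qb q L k * x ^ (n - k)

open PowerSeries

theorem sub_one_mul_qb_zero {R : Type*} [CommRing R] {q : R} (hq : IsUnit (q - 1)) (L : R) :
    (q - 1) * qb q L 0 = L := by
  rw [qb, ← mul_assoc, Ring.mul_inverse_cancel _ hq, one_mul]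

theorem sub_one_mul_qb_succ {R : Type*} [CommRing R] {q : R} (hq : IsUnit (q - 1))
    (L : R) (n : ℕ) :
    (q - 1) * qb q L (n + 1) = (if n + 1 = 1 then (1 : R) else 0) -
      q * ∑ k ∈ range (n + 1), ((n + 1).choose k : R) * qb q L k := by
  rw [qb, ← mul_assoc, Ring.mul_inverse_cancel _ hq, one_mul,
    Finset.sum_attach (range (n + 1)) fun k => ((n + 1).choose k : R) * qb q L k]

theorem rescale_C_eq {R : Type*} [CommRing R] (a r : R) : rescale a (C r) = C r := by
  ext n
  cases n <;> simp [coeff_rescale, coeff_C]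

/-- The exponential generating function `∑ f n Xⁿ / n!` of a sequence. -/
noncomputable def egf {R : Type*} [CommRing R] [Algebra ℚ R] (f : ℕ → R) : PowerSeries R :=
  PowerSeries.mk fun n => algebraMap ℚ R (1 / n.factorial) * f n

section egf

variable {R : Type*} [CommRing R] [Algebra ℚ R]

theorem egf_injective : Function.Injective (egf : (ℕ → R) → PowerSeries R) := by
  intro f g h
  funext n
  have hn := congrArg (PowerSeries.coeff n) h
  simp only [egf, coeff_mk] at hn
  have hu : IsUnit (algebraMap ℚ R (1 / n.factorial)) :=
    (IsUnit.mk0 (1 / (n.factorial : ℚ)) (by positivity)).map _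
  exact hu.mul_left_cancel hn

theorem egf_mul (f g : ℕ → R) :
    egf f * egf g =
      egf fun n => ∑ k ∈ range (n + 1), (n.choose k : R) * f k * g (n - k) := by
  ext n
  simp only [egf, coeff_mul, coeff_mk]
  rw [Finset.Nat.sum_antidiagonal_eq_sum_range_succ_mk, Finset.mul_sum]
  refine Finset.sum_congr rfl fun k hk => ?_
  have hk : k ≤ n := Nat.lt_succ_iff.mp (mem_range.mp hk)
  have h : (1 / (k.factorial : ℚ)) * (1 / ((n - k).factorial : ℚ))
      = 1 / (n.factorial : ℚ) * (n.choose k : ℚ) := by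
    rw [Nat.cast_choose ℚ hk]
    field_simp
  have h' := congrArg (algebraMap ℚ R) h
  simp only [map_mul, map_natCast] at h'
  linear_combination f k * g (n - k) * h'

theorem rescale_egf (a : R) (f : ℕ → R) :
    rescale a (egf f) = egf fun n => f n * a ^ n := by
  ext n
  simp only [egf, coeff_rescale, coeff_mk]
  ring

theorem egf_pow (a : R) : egf (fun n => a ^ n) = rescale a (exp R) := by
  ext n
  simp only [egf, coeff_rescale, coeff_mk, coeff_exp]
  ring

theorem egf_qB (q L x : R) :
    egf (fun n => qB q L n x) = egf (qb q L) * rescale x (exp R) := by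
  rw [← egf_pow, egf_mul]
  rfl

theorem egf_qS (q : R) (m : ℕ) :
    egf (fun k => qS q k m) = ∑ i ∈ range (m + 1), (C q * exp R) ^ i := by
  ext n
  simp only [egf, qS, coeff_mk, map_sum, mul_pow, ← map_pow, exp_pow_eq_rescale_exp,
    coeff_C_mul, coeff_rescale, coeff_exp, Finset.mul_sum]
  exact Finset.sum_congr rfl fun i _ => by ring

theorem mul_exp_sub_one_mul_egf_qb {q : R} (hq : IsUnit (q - 1)) (L : R) :
    (C q * exp R - 1) * egf (qb q L) = C L + X := by
  have hexp : exp R = egf fun _ => (1 : R) := by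
    ext n
    simp [egf, coeff_exp]
  have hmul : (C q * exp R - 1) * egf (qb q L) =
      C q * (egf (qb q L) * exp R) - egf (qb q L) := by ring
  rw [hmul, hexp, egf_mul]
  ext n
  cases n with
  | zero =>
    have h := sub_one_mul_qb_zero hq L
    simp [egf, -coeff_zero_eq_constantCoeff]
    linear_combination h
  | succ n =>
    have h := sub_one_mul_qb_succ hq L n
    simp only [egf, map_sub, map_add, coeff_C_mul, coeff_mk, coeff_C, coeff_X, mul_one]
    rw [Finset.sum_range_succ, Nat.choose_self, Nat.cast_one, one_mul, if_neg n.succ_ne_zero,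
      zero_add]
    have hite : algebraMap ℚ R (1 / (n + 1).factorial) * (if n + 1 = 1 then (1 : R) else 0) =
        if n + 1 = 1 then (1 : R) else 0 := by
      split_ifs with h1
      · simp [h1]
      · simp
    linear_combination algebraMap ℚ R (1 / (n + 1).factorial) * h + hite

theorem isUnit_mul_exp_sub_one {q : R} (hq : IsUnit (q - 1)) :
    IsUnit (C q * exp R - 1) := by
  rw [PowerSeries.isUnit_iff_constantCoeff]
  simpa using hq

theorem natCast_mul_egf_qb {q : R} (hq : IsUnit (q - 1)) (L : R) {w : ℕ} (hw : 0 < w)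
    (hqw : IsUnit (q ^ w - 1)) :
    C (w : R) * egf (qb q L) =
      rescale (w : R) (egf (qb (q ^ w) (w * L))) * egf (fun k => qS q k (w - 1)) := by
  apply (isUnit_mul_exp_sub_one hq).mul_left_cancel
  have h := congrArg (rescale (w : R)) (mul_exp_sub_one_mul_egf_qb hqw (w * L))
  simp only [map_mul, map_sub, map_one, map_add, rescale_X, rescale_C_eq,
    ← exp_pow_eq_rescale_exp] at h
  have hgeom := mul_geom_sum (C q * exp R) w
  rw [mul_pow, ← map_pow] at hgeom
  rw [egf_qS, Nat.sub_add_cancel hw]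
  linear_combination C (w : R) * mul_exp_sub_one_mul_egf_qb hq L - h -
    rescale (w : R) (egf (qb (q ^ w) (w * L))) * hgeom

end egf

theorem symm_bernoulli_pair_triple {R : Type*} [CommRing R] [Algebra ℚ R] (q L : R)
    (hq : ∀ w : ℕ, 0 < w → IsUnit (q ^ w - 1)) (w : ℕ) (hw : 0 < w) (y1 y2 : R) (n : ℕ) :
    (w : R) * ∑ k ∈ Finset.range (n + 1), (n.choose k : R) * qB q L k ((w : R) * y1) *
        qB (q ^ w) ((w : R) * L) (n - k) y2 * (w : R) ^ (n - k)
      = ∑ k ∈ Finset.range (n + 1), ∑ l ∈ Finset.range (n - k + 1),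
          ((n.choose k : R) * ((n - k).choose l : R)) *
            qB (q ^ w) ((w : R) * L) k y1 * qB (q ^ w) ((w : R) * L) l y2 *
            qS q (n - k - l) (w - 1) * (w : R) ^ (k + l) := by 
  have hq1 : IsUnit (q - 1) := by simpa using hq 1 one_pos
  set b := qb (q ^ w) ((w : R) * L) with hb
  set Y₁ := fun k => qB (q ^ w) ((w : R) * L) k y1 * (w : R) ^ k with hY₁
  set Y₂ := fun k => qB (q ^ w) ((w : R) * L) k y2 * (w : R) ^ k with hY₂
  set Z := fun k => qB q L k ((w : R) * y1) with hZ
  set S := fun k => qS q k (w - 1) with hS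
  have hY₁_egf : egf Y₁ = rescale (w : R) (egf b) * rescale (w * y1) (exp R) := by
    rw [hY₁, ← rescale_egf, egf_qB, map_mul, rescale_rescale, mul_comm y1]
  have key : C (w : R) * (egf Z * egf Y₂) = egf Y₁ * (egf Y₂ * egf S) := by
    rw [hZ, egf_qB, hY₁_egf]
    linear_combination rescale ((w : R) * y1) (exp R) * egf Y₂ *
      natCast_mul_egf_qb hq1 L hw (hq w hw)
  have hC : ∀ f : ℕ → R, C (w : R) * egf f = egf fun n => (w : R) * f n := by
    intro f
    ext m
    simp only [egf, coeff_C_mul, coeff_mk]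
    ring
  rw [egf_mul, egf_mul, egf_mul, hC] at key
  have h := congrFun (egf_injective key) n
  simp only [Finset.mul_sum, hY₁, hY₂, hZ, hS] at h ⊢
  convert h using 1
  · exact Finset.sum_congr rfl fun k _ => by ring
  · exact Finset.sum_congr rfl fun k _ => Finset.sum_congr rfl fun l _ => by ring
end

section
/- For a positive integer w, y1, y2 ∈ R and n ≥ 0: w · Σ_{k=0}^n C(n,k) · B_{k,q^w}(y1) · B_{n−k,q}(w·y2) · w^k = w^n · Σ_{k=0}^n C(n,k) · B_{k,q^w}(y1) · Σ_{i=0}^{w−1} q^i · B_{n−k,q^w}(y2 + i/w). -/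
open Finset

namespace QBernoulli

open PowerSeries

theorem sub_one_mul_qb_succ {R : Type*} [CommRing R] {q : R} (L : R) (hq : IsUnit (q - 1)) (n : ℕ) :
    (q - 1) * qb q L (n + 1) = (if n + 1 = 1 then 1 else 0) -
      q * ∑ k ∈ Finset.range (n + 1), ((n + 1).choose k : R) * qb q L k := by
  rw [qb, Ring.mul_inverse_cancel_left _ _ hq,
    Finset.sum_attach (Finset.range (n + 1)) fun k => ((n + 1).choose k : R) * qb q L k]

theorem rescale_C {R : Type*} [CommRing R] (a r : R) : rescale a (C r) = C r := by
  ext n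
  rw [coeff_rescale, coeff_C]
  split_ifs with h <;> simp [h]

variable {R : Type*} [CommRing R] [Algebra ℚ R]

/-- The exponential generating function `Σ f n * t ^ n / n!` of a sequence `f`. -/
noncomputable def egf (f : ℕ → R) : R⟦X⟧ :=
  PowerSeries.mk fun n => algebraMap ℚ R (1 / n.factorial) * f n

theorem coeff_egf (f : ℕ → R) (n : ℕ) :
    coeff n (egf f) = algebraMap ℚ R (1 / n.factorial) * f n :=
  coeff_mk _ _

theorem egf_mul (f g : ℕ → R) :
    egf f * egf g =
      egf fun n => ∑ k ∈ Finset.range (n + 1), (n.choose k : R) * f k * g (n - k) := by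
  ext n
  rw [coeff_mul, coeff_egf, Finset.Nat.sum_antidiagonal_eq_sum_range_succ_mk, Finset.mul_sum]
  refine Finset.sum_congr rfl fun k hk => ?_
  have hkn : k ≤ n := Nat.lt_succ_iff.mp (Finset.mem_range.mp hk)
  have h : algebraMap ℚ R (1 / n.factorial) * (n.choose k : R) =
      algebraMap ℚ R (1 / k.factorial) * algebraMap ℚ R (1 / (n - k).factorial) := by
    rw [← map_natCast (algebraMap ℚ R), ← map_mul, ← map_mul, Nat.cast_choose ℚ hkn]
    congr 1
    field_simp
  rw [coeff_egf, coeff_egf]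
  linear_combination (-(f k * g (n - k))) * h

theorem rescale_exp (x : R) : rescale x (PowerSeries.exp R) = egf fun n => x ^ n := by
  ext n
  rw [coeff_rescale, PowerSeries.coeff_exp, coeff_egf, mul_comm]

theorem rescale_rescale_exp (a x : R) :
    rescale a (rescale x (PowerSeries.exp R)) = rescale (a * x) (PowerSeries.exp R) := by
  rw [PowerSeries.rescale_rescale, mul_comm]

theorem exp_eq_egf : PowerSeries.exp R = egf fun _ => 1 := by
  simpa using rescale_exp (1 : R)

theorem egf_qB (q L x : R) :
    egf (fun n => qB q L n x) = egf (qb q L) * rescale x (PowerSeries.exp R) := by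
  rw [rescale_exp, egf_mul]
  rfl

theorem egf_qb_functional_equation {q : R} (L : R) (hq : IsUnit (q - 1)) :
    (C q * PowerSeries.exp R - 1) * egf (qb q L) = C L + X := by
  rw [sub_mul, one_mul, mul_assoc, mul_comm (PowerSeries.exp R), exp_eq_egf, egf_mul]
  ext n
  rw [map_sub, map_add, coeff_C_mul, coeff_egf, coeff_egf, coeff_C, coeff_X]
  rcases n with _ | n
  · have h : (q - 1) * qb q L 0 = L := by rw [qb, Ring.mul_inverse_cancel_left _ _ hq]
    simp
    linear_combination h
  · have h := sub_one_mul_qb_succ L hq n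
    rw [Finset.sum_range_succ]
    simp only [mul_one, Nat.choose_self, Nat.cast_one, one_mul]
    rcases n with _ | n
    · simp at h ⊢
      linear_combination h
    · simp at h ⊢
      linear_combination algebraMap ℚ R ((n + 1 + 1).factorial : ℚ)⁻¹ * h

theorem sum_mul_rescale_egf_qb {q : R} (L : R) (hq : IsUnit (q - 1)) {w : ℕ}
    (hqw : IsUnit (q ^ w - 1)) :
    (∑ i ∈ Finset.range w, (C q * PowerSeries.exp R) ^ i) *
        rescale (w : R) (egf (qb (q ^ w) ((w : R) * L))) = C (w : R) * egf (qb q L) := by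
  have hunit : IsUnit (C q * PowerSeries.exp R - 1) := by
    rw [PowerSeries.isUnit_iff_constantCoeff]
    simpa using hq
  have h₁ := egf_qb_functional_equation L hq
  have h₂ := congrArg (rescale (w : R)) (egf_qb_functional_equation ((w : R) * L) hqw)
  rw [map_mul, map_sub, map_mul, map_add, map_one, rescale_C, rescale_C, rescale_X,
    ← exp_pow_eq_rescale_exp, map_pow, ← mul_pow, map_mul] at h₂
  have h₃ := geom_sum_mul (C q * PowerSeries.exp R) w
  refine hunit.mul_left_cancel ?_
  linear_combination h₂ - C (w : R) * h₁ +
    rescale (w : R) (egf (qb (q ^ w) ((w : R) * L))) * h₃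

/-- The multiplication formula for q-Bernoulli polynomials. -/
theorem qB_mul {q : R} (L : R) (hq : IsUnit (q - 1)) {w : ℕ} (hw : 0 < w)
    (hqw : IsUnit (q ^ w - 1)) (y : R) (n : ℕ) :
    (w : R) * qB q L n (w * y) = (w : R) ^ n * ∑ i ∈ Finset.range w, q ^ i *
      qB (q ^ w) ((w : R) * L) n (y + algebraMap ℚ R ((i : ℚ) / (w : ℚ))) := by
  have hsum : C (w : R) * egf (fun n => qB q L n (w * y)) =
      ∑ i ∈ Finset.range w, C (q ^ i) * rescale (w : R) (egf fun n =>
        qB (q ^ w) ((w : R) * L) n (y + algebraMap ℚ R ((i : ℚ) / (w : ℚ)))) := by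
    rw [egf_qB, ← mul_assoc, ← sum_mul_rescale_egf_qb L hq hqw, Finset.sum_mul, Finset.sum_mul]
    refine Finset.sum_congr rfl fun i _ => ?_
    have hx : (w : R) * (y + algebraMap ℚ R ((i : ℚ) / (w : ℚ))) = w * y + i := by
      rw [mul_add, ← map_natCast (algebraMap ℚ R) w, ← map_mul,
        mul_div_cancel₀ _ (by positivity), map_natCast, map_natCast]
    rw [egf_qB, map_mul, rescale_rescale_exp, hx, ← exp_mul_exp_eq_exp_add,
      ← exp_pow_eq_rescale_exp, mul_pow, map_pow]
    ring
  have hu : IsUnit (algebraMap ℚ R (1 / n.factorial)) :=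
    (IsUnit.mk0 _ (by positivity)).map (algebraMap ℚ R)
  have hn := congrArg (coeff n) hsum
  simp only [map_sum, coeff_C_mul, coeff_rescale, coeff_egf] at hn
  refine hu.mul_left_cancel ?_
  rw [mul_left_comm, hn, Finset.mul_sum, Finset.mul_sum]
  exact Finset.sum_congr rfl fun i _ => by ring

end QBernoulli

theorem symm_bernoulli_pair_mult {R : Type*} [CommRing R] [Algebra ℚ R] (q L : R)
    (hq : ∀ w : ℕ, 0 < w → IsUnit (q ^ w - 1)) (w : ℕ) (hw : 0 < w) (y1 y2 : R) (n : ℕ) :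
    (w : R) * ∑ k ∈ Finset.range (n + 1), (n.choose k : R) * qB (q ^ w) ((w : R) * L) k y1 *
        qB q L (n - k) ((w : R) * y2) * (w : R) ^ k
      = (w : R) ^ n * ∑ k ∈ Finset.range (n + 1), (n.choose k : R) *
          qB (q ^ w) ((w : R) * L) k y1 *
          ∑ i ∈ Finset.range w, q ^ i *
            qB (q ^ w) ((w : R) * L) (n - k) (y2 + algebraMap ℚ R ((i : ℚ) / (w : ℚ))) := by
  rw [Finset.mul_sum, Finset.mul_sum]
  refine Finset.sum_congr rfl fun k hk => ?_
  have hkn : k ≤ n := Nat.lt_succ_iff.mp (Finset.mem_range.mp hk)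
  have hmul := QBernoulli.qB_mul L (by simpa using hq 1 one_pos) hw (hq w hw) y2 (n - k)
  rw [← Nat.sub_add_cancel hkn, pow_add, Nat.sub_add_cancel hkn]
  linear_combination ((n.choose k : R) * qB (q ^ w) ((w : R) * L) k y1 * (w : R) ^ k) * hmul
end
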